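/- Let p be a prime, A a finitely generated abelian group such that A ⊗_ℤ ℤ_(p) is a free ℤ_(p)-module of rank d, and let x₁, …, x_d ∈ A. Then the elements x₁ ⊗ 1, …, x_d ⊗ 1 form a ℤ_(p)-basis of A ⊗_ℤ ℤ_(p) if and only if x₁ ⊗ 1, …, x_d ⊗ 1 form a ℚ-basis of A ⊗_ℤ ℚ and, for every positive integer a, the elements x₁ ⊗ 1, …, x_d ⊗ 1 form a ℤ/p^aℤ-basis of A ⊗_ℤ ℤ/p^aℤ. -/

import Mathlib

open TensorProduct

instance spanP_isPrime (p : ℕ) [hp : Fact p.Prime] :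
    (Ideal.span {(p : ℤ)}).IsPrime :=
  (Ideal.span_singleton_prime (by exact_mod_cast hp.out.ne_zero)).mpr
    (Nat.prime_iff_prime_int.mp hp.out)

/-- The localization `ℤ_(p)` of `ℤ` at the prime `p`. -/
abbrev Zp (p : ℕ) [Fact p.Prime] : Type :=
  Localization.AtPrime (Ideal.span {(p : ℤ)})

/-- `𝒫¹ G`: the kernel of `G → Ab(G) → Ab(G) ⊗ ℤ_(p)`. -/
def pDerivedStep (p : ℕ) [Fact p.Prime] (G : Type*) [Group G] : Subgroup G where
  carrier := {g : G |
    (Additive.ofMul (Abelianization.of g) ⊗ₜ[ℤ] (1 : Zp p) :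
      Additive (Abelianization G) ⊗[ℤ] Zp p) = 0}
  one_mem' := by
    have h : Additive.ofMul (Abelianization.of (1 : G))
        = (0 : Additive (Abelianization G)) := by simp
    simp only [Set.mem_setOf_eq, h, TensorProduct.zero_tmul]
  mul_mem' := by
    intro a b ha hb
    simp only [Set.mem_setOf_eq] at *
    have h : Additive.ofMul (Abelianization.of (a * b))
        = Additive.ofMul (Abelianization.of a) + Additive.ofMul (Abelianization.of b) := by
      rw [map_mul]; rfl
    rw [h, TensorProduct.add_tmul, ha, hb, add_zero]
  inv_mem' := by
    intro a ha
    simp only [Set.mem_setOf_eq] at *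
    have h : Additive.ofMul (Abelianization.of (a⁻¹ : G))
        = -Additive.ofMul (Abelianization.of a) := by
      rw [map_inv]; rfl
    rw [h, TensorProduct.neg_tmul, ha, neg_zero]

instance pDerivedStep_normal (p : ℕ) [Fact p.Prime] (G : Type*) [Group G] :
    (pDerivedStep p G).Normal := by
  constructor
  intro a ha g
  show (Additive.ofMul (Abelianization.of (g * a * g⁻¹)) ⊗ₜ[ℤ] (1 : Zp p) :
      Additive (Abelianization G) ⊗[ℤ] Zp p) = 0
  have h : Abelianization.of (g * a * g⁻¹) = Abelianization.of a := by
    rw [map_mul, map_mul, map_inv, mul_comm, inv_mul_cancel_left]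
  rw [h]; exact ha

/-- The `ℤ_(p)`-coefficient derived series `𝒫ⁿ G`. -/
def pDerivedSeries (p : ℕ) [Fact p.Prime] (G : Type*) [Group G] : ℕ → Subgroup G
  | 0 => ⊤
  | n + 1 => Subgroup.map (pDerivedSeries p G n).subtype
      (pDerivedStep p (pDerivedSeries p G n))

/-- Base change along `f : R →+* S` preserves bases of the form `1 ⊗ xᵢ`. -/
theorem linearIndependent_and_span_one_tmul_of_ringHom {R S A ι : Type*} [CommRing R] [CommRing S]
    [AddCommGroup A] (f : R →+* S) {x : ι → A}
    (h : LinearIndependent R (fun i => ((1 : R) ⊗ₜ[ℤ] x i : R ⊗[ℤ] A)) ∧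
      Submodule.span R (Set.range fun i => ((1 : R) ⊗ₜ[ℤ] x i : R ⊗[ℤ] A)) = ⊤) :
    LinearIndependent S (fun i => ((1 : S) ⊗ₜ[ℤ] x i : S ⊗[ℤ] A)) ∧
      Submodule.span S (Set.range fun i => ((1 : S) ⊗ₜ[ℤ] x i : S ⊗[ℤ] A)) = ⊤ := by
  let : Algebra R S := f.toAlgebra
  let b := ((Module.Basis.mk h.1 h.2.ge).baseChange S).map
    (AlgebraTensorModule.cancelBaseChange ℤ R S S A)
  have hb : (fun i => ((1 : S) ⊗ₜ[ℤ] x i : S ⊗[ℤ] A)) = b := by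
    funext i
    simp [b]
  rw [hb]
  exact ⟨b.linearIndependent, b.span_eq⟩

/-- A basis of `S ⊗ A` of the form `1 ⊗ xᵢ` is also one of `S ⊗[R] (R ⊗ A)`. -/
theorem exists_basis_tmul_one_tmul {R S A ι : Type*} [CommRing R] [CommRing S] [Algebra R S]
    [AddCommGroup A] {x : ι → A}
    (h : LinearIndependent S (fun i => ((1 : S) ⊗ₜ[ℤ] x i : S ⊗[ℤ] A)) ∧
      Submodule.span S (Set.range fun i => ((1 : S) ⊗ₜ[ℤ] x i : S ⊗[ℤ] A)) = ⊤) :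
    ∃ b : Module.Basis ι S (S ⊗[R] (R ⊗[ℤ] A)),
      ∀ i, (1 : S) ⊗ₜ[R] ((1 : R) ⊗ₜ[ℤ] x i) = b i :=
  ⟨(Module.Basis.mk h.1 h.2.ge).map (AlgebraTensorModule.cancelBaseChange ℤ R S S A).symm,
    fun i => by simp⟩

/-- Over a local ring `R`, if the `1 ⊗ xᵢ` form a basis over a ring mapping to the residue field,
they span `R ⊗ A`. -/
theorem span_one_tmul_eq_top_of_ringHom_residueField {R K A ι : Type*} [CommRing R] [IsLocalRing R]
    [CommRing K] [AddCommGroup A] [Module.Finite ℤ A] (f : K →+* IsLocalRing.ResidueField R)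
    {x : ι → A}
    (h : LinearIndependent K (fun i => ((1 : K) ⊗ₜ[ℤ] x i : K ⊗[ℤ] A)) ∧
      Submodule.span K (Set.range fun i => ((1 : K) ⊗ₜ[ℤ] x i : K ⊗[ℤ] A)) = ⊤) :
    Submodule.span R (Set.range fun i => ((1 : R) ⊗ₜ[ℤ] x i : R ⊗[ℤ] A)) = ⊤ := by
  obtain ⟨b, hb⟩ := exists_basis_tmul_one_tmul (R := R)
    (linearIndependent_and_span_one_tmul_of_ringHom f h)
  exact IsLocalRing.span_eq_top_of_tmul_eq_basis _ b hb

theorem not_dvd_of_mem_primeCompl_span {p : ℕ} [Fact p.Prime]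
    (y : (Ideal.span {(p : ℤ)}).primeCompl) : ¬ (p : ℤ) ∣ y :=
  fun h => y.2 (Ideal.mem_span_singleton.mpr h)

theorem ZMod.isUnit_intCast_of_not_dvd {p : ℕ} [hp : Fact p.Prime] {m : ℤ} (h : ¬ (p : ℤ) ∣ m)
    (a : ℕ) : IsUnit (m : ZMod (p ^ a)) := by
  have hc : IsCoprime m ((p ^ a : ℕ) : ℤ) := by
    push_cast
    exact ((Nat.prime_iff_prime_int.mp hp.out).coprime_iff_not_dvd.mpr h).symm.pow_right
  obtain ⟨u, v, huv⟩ := hc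
  refine IsUnit.of_mul_eq_one_right (u : ZMod (p ^ a)) ?_
  have := congrArg (Int.cast : ℤ → ZMod (p ^ a)) huv
  rw [Int.cast_add, Int.cast_mul, Int.cast_mul, Int.cast_natCast, ZMod.natCast_self] at this
  simpa using this

/-- The ring homomorphism `ℤ_(p) → ℚ`. -/
noncomputable def Zp.toRat (p : ℕ) [Fact p.Prime] : Zp p →+* ℚ :=
  IsLocalization.lift (M := (Ideal.span {(p : ℤ)}).primeCompl) (g := Int.castRingHom ℚ) fun y => by
    have h : (y : ℤ) ≠ 0 := fun h0 => not_dvd_of_mem_primeCompl_span y (h0 ▸ dvd_zero _)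
    simpa using h

/-- The ring homomorphism `ℤ_(p) → ℤ/p^aℤ`. -/
noncomputable def Zp.toZModPow (p : ℕ) [Fact p.Prime] (a : ℕ) : Zp p →+* ZMod (p ^ a) :=
  IsLocalization.lift (M := (Ideal.span {(p : ℤ)}).primeCompl)
    (g := Int.castRingHom (ZMod (p ^ a))) fun y =>
      ZMod.isUnit_intCast_of_not_dvd (not_dvd_of_mem_primeCompl_span y) a

instance Zp.charP_residueField (p : ℕ) [hp : Fact p.Prime] :
    CharP (IsLocalRing.ResidueField (Zp p)) p := by
  have h : ((p : ℕ) : IsLocalRing.ResidueField (Zp p)) = 0 := by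
    rw [← map_natCast (IsLocalRing.residue (Zp p)), IsLocalRing.residue_eq_zero_iff]
    have := (IsLocalization.AtPrime.to_map_mem_maximal_iff (Zp p) (Ideal.span {(p : ℤ)})
      (p : ℤ)).mpr (Ideal.mem_span_singleton_self _)
    simpa using this
  exact (CharP.charP_iff_prime_eq_zero hp.out).mpr h

/-- given `A` finitely generated with `A ⊗ ℤ_(p)` free of rank `d`,
elements `x₁ ⊗ 1, …, x_d ⊗ 1` form a `ℤ_(p)`-basis of `A ⊗ ℤ_(p)` iff they form a
`ℚ`-basis of `A ⊗ ℚ` and a `ℤ/p^aℤ`-basis of `A ⊗ ℤ/p^aℤ` for every `a > 0`.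
(The coefficient factor is written on the left so that it carries the module
structure.) -/
theorem basis_tensor_zp_iff (p : ℕ) [Fact p.Prime]
    {A : Type*} [AddCommGroup A] [Module.Finite ℤ A] (d : ℕ)
    (hfree : Module.Free (Zp p) (Zp p ⊗[ℤ] A))
    (hrank : Module.finrank (Zp p) (Zp p ⊗[ℤ] A) = d)
    (x : Fin d → A) :
    (LinearIndependent (Zp p) (fun i => ((1 : Zp p) ⊗ₜ[ℤ] x i : Zp p ⊗[ℤ] A)) ∧
        Submodule.span (Zp p)
          (Set.range fun i => ((1 : Zp p) ⊗ₜ[ℤ] x i : Zp p ⊗[ℤ] A)) = ⊤) ↔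
      ((LinearIndependent ℚ (fun i => ((1 : ℚ) ⊗ₜ[ℤ] x i : ℚ ⊗[ℤ] A)) ∧
          Submodule.span ℚ
            (Set.range fun i => ((1 : ℚ) ⊗ₜ[ℤ] x i : ℚ ⊗[ℤ] A)) = ⊤) ∧
        ∀ a : ℕ, 0 < a →
          (LinearIndependent (ZMod (p ^ a))
              (fun i => ((1 : ZMod (p ^ a)) ⊗ₜ[ℤ] x i : ZMod (p ^ a) ⊗[ℤ] A)) ∧
            Submodule.span (ZMod (p ^ a))
              (Set.range fun i =>
                ((1 : ZMod (p ^ a)) ⊗ₜ[ℤ] x i : ZMod (p ^ a) ⊗[ℤ] A)) = ⊤)) := by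
  constructor
  · intro h
    exact ⟨linearIndependent_and_span_one_tmul_of_ringHom (Zp.toRat p) h, fun a _ =>
      linearIndependent_and_span_one_tmul_of_ringHom (Zp.toZModPow p a) h⟩
  · rintro ⟨-, h⟩
    have hs := span_one_tmul_eq_top_of_ringHom_residueField (R := Zp p)
      (ZMod.castHom (pow_one p).symm.dvd (IsLocalRing.ResidueField (Zp p))) (h 1 one_pos)
    exact ⟨linearIndependent_of_top_le_span_of_card_eq_finrank hs.ge (by simp [hrank]), hs⟩
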